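/- There exists a real constant c ≠ 0, independent of k and l, such that for all k, l ∈ ℤ²₊ with k ≠ l the vector field b(e_k¹, e_l¹) − b(e_l¹, e_k¹) + b(e_k⁰, e_l⁰) − b(e_l⁰, e_k⁰) equals a(k,l) · c · |k−l| · e¹_{k−l} modulo a gradient. (This is the third identity of the magnetic-direction Lie bracket lemma: Z_{k,l}^{1,1} + Z_{k,l}^{0,0} = a c |k−l| σ¹_{k−l}.) -/

import Mathlib

/-- Euclidean norm of an integer lattice vector `k ∈ ℤ²`. -/
noncomputable def knorm (k : ℤ × ℤ) : ℝ := Real.sqrt ((k.1 : ℝ) ^ 2 + (k.2 : ℝ) ^ 2)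

/-- The phase `k ⋅ x = k₁ x₁ + k₂ x₂`. -/
noncomputable def phase (k : ℤ × ℤ) (x : ℝ × ℝ) : ℝ := (k.1 : ℝ) * x.1 + (k.2 : ℝ) * x.2

/-- The divergence-free trigonometric vector field
`e_k⁰(x) = |k|⁻¹ (k₂, −k₁) cos(k ⋅ x)`. -/
noncomputable def e0 (k : ℤ × ℤ) (x : ℝ × ℝ) : ℝ × ℝ :=
  (((k.2 : ℝ) / knorm k) * Real.cos (phase k x),
   ((-(k.1 : ℝ)) / knorm k) * Real.cos (phase k x))

/-- The divergence-free trigonometric vector field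
`e_k¹(x) = |k|⁻¹ (−k₂, k₁) sin(k ⋅ x)`. -/
noncomputable def e1 (k : ℤ × ℤ) (x : ℝ × ℝ) : ℝ × ℝ :=
  (((-(k.2 : ℝ)) / knorm k) * Real.sin (phase k x),
   ((k.1 : ℝ) / knorm k) * Real.sin (phase k x))

/-- The advection operator `b(u,v) = (u ⋅ ∇)v`, i.e. the derivative of `v`
in the direction `u(x)`. -/
noncomputable def advect (u v : ℝ × ℝ → ℝ × ℝ) (x : ℝ × ℝ) : ℝ × ℝ :=
  fderiv ℝ v x (u x)

/-- The coefficient `a(k,l) = ⟨k, l^⊥⟩ / (|k| |l|)` with `l^⊥ = (−l₂, l₁)`. -/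
noncomputable def acoef (k l : ℤ × ℤ) : ℝ :=
  ((k.1 : ℝ) * (-(l.2 : ℝ)) + (k.2 : ℝ) * (l.1 : ℝ)) / (knorm k * knorm l)

/-- The half lattice `ℤ²₊ = {j ∈ ℤ² \ {0} : j₁ > 0, or j₁ = 0 and j₂ > 0}`. -/
def Zpos : Set (ℤ × ℤ) := {j | 0 < j.1 ∨ (j.1 = 0 ∧ 0 < j.2)}

/-- `F` equals `G` modulo a gradient: there exists a smooth `2π`-periodic
function `p : ℝ² → ℝ` with `F = G + ∇p`. -/
def EqModGrad (F G : ℝ × ℝ → ℝ × ℝ) : Prop :=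
  ∃ p : ℝ × ℝ → ℝ, ContDiff ℝ (⊤ : ℕ∞) p ∧
    (∀ x : ℝ × ℝ, p (x.1 + 2 * Real.pi, x.2) = p x ∧ p (x.1, x.2 + 2 * Real.pi) = p x) ∧
    ∀ x : ℝ × ℝ, F x = G x + (fderiv ℝ p x (1, 0), fderiv ℝ p x (0, 1))

lemma knorm_ne_zero {k : ℤ × ℤ} (hk : k ≠ 0) : knorm k ≠ 0 := by
  refine (Real.sqrt_pos.2 ?_).ne'
  by_cases h : k.1 = 0
  · have h2 : (k.2 : ℝ) ≠ 0 := Int.cast_ne_zero.2 fun h2 => hk (Prod.ext h h2)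
    positivity
  · have h1 : (k.1 : ℝ) ≠ 0 := Int.cast_ne_zero.2 h
    positivity

lemma phase_sub (k l : ℤ × ℤ) (x : ℝ × ℝ) : phase (k - l) x = phase k x - phase l x := by
  simp only [phase, Prod.fst_sub, Prod.snd_sub, Int.cast_sub]
  ring

lemma hasFDerivAt_phase (k : ℤ × ℤ) (x : ℝ × ℝ) :
    HasFDerivAt (phase k)
      ((k.1 : ℝ) • ContinuousLinearMap.fst ℝ ℝ ℝ + (k.2 : ℝ) • ContinuousLinearMap.snd ℝ ℝ ℝ) x :=
  (hasFDerivAt_fst.const_mul _).add (hasFDerivAt_snd.const_mul _)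

lemma advect_e1 (u : ℝ × ℝ → ℝ × ℝ) (l : ℤ × ℤ) (x : ℝ × ℝ) :
    advect u (e1 l) x =
      (-(l.2 : ℝ) / knorm l * (Real.cos (phase l x) * phase l (u x)),
        (l.1 : ℝ) / knorm l * (Real.cos (phase l x) * phase l (u x))) := by
  have h := (hasFDerivAt_phase l x).sin
  have := (h.const_mul (-(l.2 : ℝ) / knorm l)).prodMk (h.const_mul ((l.1 : ℝ) / knorm l))
  rw [advect, HasFDerivAt.fderiv (f := e1 l) this]
  ext <;> simp [phase] <;> ring

lemma advect_e0 (u : ℝ × ℝ → ℝ × ℝ) (l : ℤ × ℤ) (x : ℝ × ℝ) :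
    advect u (e0 l) x =
      ((l.2 : ℝ) / knorm l * (-Real.sin (phase l x) * phase l (u x)),
        -(l.1 : ℝ) / knorm l * (-Real.sin (phase l x) * phase l (u x))) := by
  have h := (hasFDerivAt_phase l x).cos
  have := (h.const_mul ((l.2 : ℝ) / knorm l)).prodMk (h.const_mul (-(l.1 : ℝ) / knorm l))
  rw [advect, HasFDerivAt.fderiv (f := e0 l) this]
  ext <;> simp [phase] <;> ring

lemma EqModGrad.of_eq {F G : ℝ × ℝ → ℝ × ℝ} (h : ∀ x, F x = G x) : EqModGrad F G :=
  ⟨fun _ => 0, contDiff_const, fun _ => ⟨rfl, rfl⟩, fun x => by simp [h x]⟩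

lemma knorm_smul_e1 {k : ℤ × ℤ} (hk : k ≠ 0) (x : ℝ × ℝ) :
    knorm k • e1 k x = (-(k.2 : ℝ) * Real.sin (phase k x), (k.1 : ℝ) * Real.sin (phase k x)) := by
  have := knorm_ne_zero hk
  ext <;> simp only [e1, Prod.smul_mk, smul_eq_mul] <;> field_simp

lemma phase_e1 (k l : ℤ × ℤ) (x : ℝ × ℝ) :
    phase l (e1 k x) =
      ((l.2 : ℝ) * k.1 - (l.1 : ℝ) * k.2) / knorm k * Real.sin (phase k x) := by
  simp only [phase, e1]
  ring

lemma phase_e0 (k l : ℤ × ℤ) (x : ℝ × ℝ) :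
    phase l (e0 k x) =
      ((l.1 : ℝ) * k.2 - (l.2 : ℝ) * k.1) / knorm k * Real.cos (phase k x) := by
  simp only [phase, e0]
  ring

theorem magnetic_lie_bracket_diff_plus :
    ∃ c : ℝ, c ≠ 0 ∧ ∀ k l : ℤ × ℤ, k ∈ Zpos → l ∈ Zpos → k ≠ l →
      EqModGrad
        (fun x => advect (e1 k) (e1 l) x - advect (e1 l) (e1 k) x + advect (e0 k) (e0 l) x - advect (e0 l) (e0 k) x)
        (fun x => (acoef k l * c * (knorm (k - l))) • e1 (k - l) x) := by
  refine ⟨1, one_ne_zero, fun k l _ _ hkl => EqModGrad.of_eq fun x => ?_⟩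
  rw [mul_smul, knorm_smul_e1 (sub_ne_zero.2 hkl), phase_sub, Real.sin_sub]
  simp only [advect_e1, advect_e0, phase_e1, phase_e0, acoef, Prod.fst_sub, Prod.snd_sub,
    Int.cast_sub, Prod.smul_mk, smul_eq_mul, Prod.mk_sub_mk, Prod.mk_add_mk]
  ext <;> simp only <;> ring
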